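/- Unframing out of a sum (sum-unframe): let P, Q, R be SL propositions such that P and R are unambiguous and R is precise and nonnb. Then the entailment (P * R) + (Q * R) ⊢ (P + Q) * R holds. -/

import Mathlib

open scoped Classical

noncomputable section

namespace QSL

/-! ## Resources -/

/-- Vectors over the Hilbert space with orthonormal basis indexed by `Q → {0,1}`. -/
def Vec {Qubit : Type} (Q : Finset Qubit) : Type := ({ q // q ∈ Q } → Bool) → ℂ

/-- A quantum state: a finite set of qubits together with a vector over them. -/
def QState (Qubit : Type) : Type := Σ Q : Finset Qubit, Vec Q

/-- A store: a partial function from variables to values. -/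
def Store (Var Val : Type) : Type := Var → Option Val

/-- A resource: a quantum state together with a store. -/
def Res (Qubit Var Val : Type) : Type := QState Qubit × Store Var Val

variable {Qubit Var Val : Type}

/-- Tensor product of vectors over disjoint qubit sets. -/
def tensorVec {Q Q' : Finset Qubit} (v : Vec Q) (w : Vec Q') : Vec (Q ∪ Q') := fun f =>
  v (fun q => f ⟨q.1, Finset.mem_union_left _ q.2⟩) *
  w (fun q => f ⟨q.1, Finset.mem_union_right _ q.2⟩)

/-- Transport of a vector along an equality of qubit sets. -/
def castVec {Q Q' : Finset Qubit} (h : Q = Q') (v : Vec Q) : Vec Q' := h ▸ v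

/-- The empty quantum state with scalar 1. -/
def unitQ : QState Qubit := ⟨(∅ : Finset Qubit), fun _ => 1⟩

/-- The unit resource: empty qubit set with scalar 1 and the empty store. -/
def unitRes : Res Qubit Var Val := (unitQ, fun _ => none)

/-- Partial product of resources: defined iff the qubit sets are disjoint and
the store domains are disjoint; takes the union of qubit sets, tensor product of
vectors, and union of stores. -/
def rmul (a b : Res Qubit Var Val) : Option (Res Qubit Var Val) :=
  if h : Disjoint a.1.1 b.1.1 ∧ ∀ x, a.2 x = none ∨ b.2 x = none then
    some (⟨a.1.1 ∪ b.1.1, tensorVec a.1.2 b.1.2⟩, fun x => a.2 x <|> b.2 x)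
  else none

/-- Partial sum of resources: defined iff the two resources have the same
qubit set and the same store; adds the vectors. -/
def radd (a b : Res Qubit Var Val) : Option (Res Qubit Var Val) :=
  if h : a.1.1 = b.1.1 ∧ a.2 = b.2 then
    some (⟨b.1.1, fun f => castVec h.1 a.1.2 f + b.1.2 f⟩, b.2)
  else none

/-- Incompatibility of resources: some variable lies in both store domains and
the stores disagree on it. -/
def incompat (a b : Res Qubit Var Val) : Prop :=
  ∃ x u u', a.2 x = some u ∧ b.2 x = some u' ∧ u ≠ u'

/-! ## Multisets (possibly infinite, as families up to bijective reindexing) -/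

/-- An indexed family representing a multiset. -/
structure PreMSet (A : Type) : Type 1 where
  idx : Type
  val : idx → A

/-- Equivalence of indexed families by bijective reindexing. -/
def msetEquiv {A : Type} (f g : PreMSet A) : Prop :=
  ∃ e : f.idx ≃ g.idx, ∀ i, f.val i = g.val (e i)

theorem msetEquiv_refl {A : Type} (f : PreMSet A) : msetEquiv f f :=
  ⟨Equiv.refl _, fun _ => rfl⟩

theorem msetEquiv_symm {A : Type} {f g : PreMSet A} : msetEquiv f g → msetEquiv g f
  | ⟨e, h⟩ => ⟨e.symm, fun i => by rw [h (e.symm i), Equiv.apply_symm_apply]⟩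

theorem msetEquiv_trans {A : Type} {f g k : PreMSet A} :
    msetEquiv f g → msetEquiv g k → msetEquiv f k
  | ⟨e, h⟩, ⟨e', h'⟩ => ⟨e.trans e', fun i => (h i).trans (h' (e i))⟩

instance msetSetoid (A : Type) : Setoid (PreMSet A) :=
  ⟨msetEquiv, ⟨msetEquiv_refl, msetEquiv_symm, msetEquiv_trans⟩⟩

/-- Multisets over `A`: families up to bijective reindexing. -/
def MSet (A : Type) : Type 1 := Quotient (msetSetoid A)

def MSet.mk {A : Type} (I : Type) (f : I → A) : MSet A :=
  Quotient.mk (msetSetoid A) ⟨I, f⟩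

/-- A canonical representative family of a multiset. -/
def MSet.out {A : Type} (m : MSet A) : PreMSet A := Quotient.out m

/-- `a` is an occurrence of the multiset `m`. -/
def MSet.MemM {A : Type} (a : A) (m : MSet A) : Prop := ∃ i, m.out.val i = a

def MSet.map {A B : Type} (f : A → B) (m : MSet A) : MSet B :=
  MSet.mk m.out.idx (fun i => f (m.out.val i))

/-- Sum (disjoint union) of two multisets. -/
def MSet.uplus {A : Type} (m m' : MSet A) : MSet A :=
  MSet.mk (m.out.idx ⊕ m'.out.idx) (Sum.elim m.out.val m'.out.val)

/-- Indexed sum (disjoint union) of a family of multisets. -/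
def MSet.biguplus {A : Type} (I : Type) (f : I → MSet A) : MSet A :=
  MSet.mk (Σ x : I, (f x).out.idx) (fun p => (f p.1).out.val p.2)


/-- Partial product of multisets of resources: an occurrence `a·b` for every
pair of occurrences, defined iff all these resource products are defined. -/
def mprodM (m m' : MSet (Res Qubit Var Val)) : Option (MSet (Res Qubit Var Val)) :=
  if h : ∀ (i : m.out.idx) (j : m'.out.idx), (rmul (m.out.val i) (m'.out.val j)).isSome then
    some (MSet.mk (m.out.idx × m'.out.idx)
      (fun p => (rmul (m.out.val p.1) (m'.out.val p.2)).get (h p.1 p.2)))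
  else none

/-- Sum of the two projections of a multiset of pairs of resources (the
multiset of pairs plays the role of a multiset bijection between its two
projections): defined iff all the componentwise resource sums are defined. -/
def msumr (r : MSet (Res Qubit Var Val × Res Qubit Var Val)) :
    Option (MSet (Res Qubit Var Val)) :=
  if h : ∀ i, (radd (r.out.val i).1 (r.out.val i).2).isSome then
    some (MSet.mk r.out.idx (fun i => (radd (r.out.val i).1 (r.out.val i).2).get (h i)))
  else none

/-! ## SL propositions -/

/-- An SL proposition: a set of multisets of resources. -/
abbrev SLProp (Qubit Var Val : Type) : Type 1 := Set (MSet (Res Qubit Var Val))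


/-- Entailment of SL propositions: set inclusion. -/
def entails (P Q : SLProp Qubit Var Val) : Prop := P ⊆ Q

/-- Separating conjunction. -/
def star (P Q : SLProp Qubit Var Val) : SLProp Qubit Var Val :=
  { m | ∃ mp ∈ P, ∃ mq ∈ Q, mprodM mp mq = some m }

/-- Sum of SL propositions: all defined sums `m +_r m'` over `m ∈ P`, `m' ∈ Q`
and multiset bijections `r` between `m` and `m'`. -/
def propSum (P Q : SLProp Qubit Var Val) : SLProp Qubit Var Val :=
  { m | ∃ r : MSet (Res Qubit Var Val × Res Qubit Var Val),
      MSet.map Prod.fst r ∈ P ∧ MSet.map Prod.snd r ∈ Q ∧ msumr r = some m }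

/-- Indexed bare mixing. -/
def bigMix (I : Type) (P : I → SLProp Qubit Var Val) : SLProp Qubit Var Val :=
  { m | ∃ f : I → MSet (Res Qubit Var Val), (∀ x, f x ∈ P x) ∧ m = MSet.biguplus I f }

/-- Binary bare mixing, the case of `bigMix` over a two-element index set. -/
def binMix (P Q : SLProp Qubit Var Val) : SLProp Qubit Var Val :=
  bigMix Bool (fun b => if b then Q else P)

/-- Precision: any two multisets in `P` are equal. -/
def precise (P : SLProp Qubit Var Val) : Prop := ∀ m ∈ P, ∀ m' ∈ P, m = m'

/-- Non-emptiness of behaviours: every multiset in `P` is nonempty. -/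
def nonnb (P : SLProp Qubit Var Val) : Prop := ∀ m ∈ P, Nonempty (MSet.out m).idx

/-- Unambiguity: any two occurrences at distinct indices are incompatible. -/
def unambig (P : SLProp Qubit Var Val) : Prop :=
  ∀ m ∈ P, ∀ i j : (MSet.out m).idx, i ≠ j → incompat (m.out.val i) (m.out.val j)

/-- Incompatibility of SL propositions: every occurrence of every `m ∈ P` is
incompatible with every occurrence of every `m' ∈ Q`. -/
def propIncompat (P Q : SLProp Qubit Var Val) : Prop :=
  ∀ m ∈ P, ∀ m' ∈ Q, ∀ (i : (MSet.out m).idx) (j : (MSet.out m').idx),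
    incompat (m.out.val i) (m'.out.val j)

/-- The singleton proposition of the one-element multiset of a resource. -/
def singletonProp (a : Res Qubit Var Val) : SLProp Qubit Var Val :=
  { m | m = MSet.mk PUnit (fun _ => a) }

/-- The points-to proposition `ι ↦ v`: empty quantum state (scalar 1) and the
store mapping only `ι` to `v`. -/
def varPoints (ι : Var) (v : Val) : SLProp Qubit Var Val :=
  singletonProp (unitQ, fun y => if y = ι then some v else none)

/-- Tagged mixing over an index set of values. -/
def taggedMix (ι : Var) (I : Set Val) (P : Val → SLProp Qubit Var Val) :
    SLProp Qubit Var Val :=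
  bigMix I (fun x => star (varPoints ι x.1) (P x.1))

theorem MSet.mk_eq {A : Type} {I J : Type} {f : I → A} {g : J → A} (e : I ≃ J)
    (h : ∀ i, f i = g (e i)) : MSet.mk I f = MSet.mk J g :=
  Quotient.sound (s := msetSetoid A) ⟨e, h⟩

theorem MSet.mk_out {A : Type} (m : MSet A) : MSet.mk m.out.idx m.out.val = m :=
  Quotient.out_eq (s := msetSetoid A) m

theorem MSet.exact {A : Type} {I J : Type} {f : I → A} {g : J → A}
    (h : MSet.mk I f = MSet.mk J g) : ∃ e : I ≃ J, ∀ i, f i = g (e i) :=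
  Quotient.exact (s := msetSetoid A) h

theorem MSet.out_mk {A : Type} {I : Type} (f : I → A) :
    ∃ e : (MSet.mk I f).out.idx ≃ I, ∀ i, (MSet.mk I f).out.val i = f (e i) :=
  MSet.exact (MSet.mk_out _)

theorem MSet.map_mk {A B : Type} {I : Type} (f : I → A) (g : A → B) :
    MSet.map g (MSet.mk I f) = MSet.mk I (fun i => g (f i)) := by
  obtain ⟨e, he⟩ := MSet.out_mk f
  exact MSet.mk_eq e (fun i => by rw [he])

theorem mprodM_elim {m m' M : MSet (Res Qubit Var Val)} (h : mprodM m m' = some M) :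
    ∃ k : m.out.idx × m'.out.idx → Res Qubit Var Val,
      (∀ x, rmul (m.out.val x.1) (m'.out.val x.2) = some (k x)) ∧ M = MSet.mk _ k := by
  unfold mprodM at h
  split_ifs at h with h0
  exact ⟨_, fun x => (Option.some_get (h0 x.1 x.2)).symm, (Option.some.inj h).symm⟩

theorem msumr_elim {r : MSet (Res Qubit Var Val × Res Qubit Var Val)}
    {M : MSet (Res Qubit Var Val)} (h : msumr r = some M) :
    ∃ k : r.out.idx → Res Qubit Var Val,
      (∀ x, radd (r.out.val x).1 (r.out.val x).2 = some (k x)) ∧ M = MSet.mk _ k := by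
  unfold msumr at h
  split_ifs at h with h0
  exact ⟨_, fun x => (Option.some_get (h0 x)).symm, (Option.some.inj h).symm⟩

theorem mprodM_intro {I J : Type} {f : I → Res Qubit Var Val} {g : J → Res Qubit Var Val}
    {k : I × J → Res Qubit Var Val} (h : ∀ x, rmul (f x.1) (g x.2) = some (k x)) :
    mprodM (MSet.mk I f) (MSet.mk J g) = some (MSet.mk (I × J) k) := by
  obtain ⟨e, he⟩ := MSet.out_mk f
  obtain ⟨e', he'⟩ := MSet.out_mk g
  have H : ∀ i j, rmul ((MSet.mk I f).out.val i) ((MSet.mk J g).out.val j)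
      = some (k (e i, e' j)) := fun i j => by rw [he, he']; exact h (e i, e' j)
  unfold mprodM
  rw [dif_pos (fun i j => by rw [H]; rfl)]
  congr 1
  refine MSet.mk_eq (Equiv.prodCongr e e') (fun x => ?_)
  exact Option.get_of_eq_some _ (H x.1 x.2)

theorem msumr_intro {I : Type} {f : I → Res Qubit Var Val × Res Qubit Var Val}
    {k : I → Res Qubit Var Val} (h : ∀ x, radd (f x).1 (f x).2 = some (k x)) :
    msumr (MSet.mk I f) = some (MSet.mk I k) := by
  obtain ⟨e, he⟩ := MSet.out_mk f
  have H : ∀ i, radd ((MSet.mk I f).out.val i).1 ((MSet.mk I f).out.val i).2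
      = some (k (e i)) := fun i => by rw [he]; exact h (e i)
  unfold msumr
  rw [dif_pos (fun i => by rw [H]; rfl)]
  congr 1
  refine MSet.mk_eq e (fun x => ?_)
  exact Option.get_of_eq_some _ (H x)

theorem rmul_elim {a b c : Res Qubit Var Val} (h : rmul a b = some c) :
    (Disjoint a.1.1 b.1.1 ∧ ∀ x, a.2 x = none ∨ b.2 x = none) ∧
    c = (⟨a.1.1 ∪ b.1.1, tensorVec a.1.2 b.1.2⟩, fun x => a.2 x <|> b.2 x) := by
  unfold rmul at h
  split_ifs at h with h0
  exact ⟨h0, (Option.some.inj h).symm⟩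

theorem radd_store {a b c : Res Qubit Var Val} (h : radd a b = some c) :
    a.1.1 = b.1.1 ∧ a.2 = b.2 := by
  unfold radd at h
  split_ifs at h with h0
  exact h0

theorem key_compat {a b c a' b' c' d : Res Qubit Var Val} (h : rmul a b = some c)
    (h' : rmul a' b' = some c') (hd : radd c c' = some d) : ¬ incompat b b' := by
  rintro ⟨x, u, u', hu, hu', hne⟩
  obtain ⟨⟨-, h1⟩, rfl⟩ := rmul_elim h
  obtain ⟨⟨-, h2⟩, rfl⟩ := rmul_elim h'
  have := congrFun (radd_store hd).2 x
  have e1 := h1 x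
  have e2 := h2 x
  simp_all

theorem key_add {a b c a' c' d : Res Qubit Var Val} (h : rmul a b = some c)
    (h' : rmul a' b = some c') (hd : radd c c' = some d) :
    ∃ s, radd a a' = some s ∧ rmul s b = some d := by
  obtain ⟨⟨h1, h2⟩, rfl⟩ := rmul_elim h
  obtain ⟨⟨h3, h4⟩, rfl⟩ := rmul_elim h'
  obtain ⟨hq, hs⟩ := radd_store hd
  have hs' : a.2 = a'.2 := by
    funext x
    have := congrFun hs x
    have e1 := h2 x
    have e2 := h4 x
    rcases hb : b.2 x with _ | v <;> simp_all
  have hq' : a.1.1 = a'.1.1 := by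
    have hq : a.1.1 ∪ b.1.1 = a'.1.1 ∪ b.1.1 := hq
    ext y
    have := Finset.ext_iff.1 hq y
    have d1 : y ∈ a.1.1 → y ∉ b.1.1 := fun hy => Finset.disjoint_left.1 h1 hy
    have d2 : y ∈ a'.1.1 → y ∉ b.1.1 := fun hy => Finset.disjoint_left.1 h3 hy
    simp only [Finset.mem_union] at this
    tauto
  obtain ⟨⟨A, v⟩, s⟩ := a
  obtain ⟨⟨A', v'⟩, s'⟩ := a'
  dsimp only at hq' hs'
  subst hq' hs'
  refine ⟨_, dif_pos ⟨rfl, rfl⟩, ?_⟩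
  rw [← hd]
  unfold radd
  rw [dif_pos ⟨rfl, rfl⟩]
  unfold rmul
  rw [dif_pos ⟨h3, h4⟩]
  congr 3
  congr 1
  funext f
  exact add_mul _ _ _

/-- Unframing out of a sum: `(P * R) + (Q * R) ⊢ (P + Q) * R` when `P` and `R`
are unambiguous and `R` is precise and nonnb. -/
theorem sum_unframe {Qubit Var Val : Type} (P Q R : SLProp Qubit Var Val)
    (hPu : unambig P) (hRu : unambig R) (hRp : precise R) (hRn : nonnb R) :
    entails (propSum (star P R) (star Q R)) (star (propSum P Q) R) := by
  rintro m ⟨r, ⟨mp, hmp, mr, hmr, hp⟩, ⟨mq, hmq, mr', hmr', hq⟩, hm⟩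
  obtain rfl := hRp mr hmr mr' hmr'
  obtain ⟨k1, hk1, hE1⟩ := mprodM_elim hp
  obtain ⟨k2, hk2, hE2⟩ := mprodM_elim hq
  obtain ⟨d, hd, rfl⟩ := msumr_elim hm
  obtain ⟨e1, he1⟩ := MSet.exact hE1
  obtain ⟨e2, he2⟩ := MSet.exact hE2
  obtain ⟨j0⟩ := hRn mr hmr
  let E : mp.out.idx × mr.out.idx ≃ mq.out.idx × mr.out.idx := e1.symm.trans e2
  have hsum : ∀ x, radd (k1 x) (k2 (E x)) = some (d (e1.symm x)) := by
    intro x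
    have := hd (e1.symm x)
    rw [he1, he2, Equiv.apply_symm_apply] at this
    exact this
  have hE : ∀ x, (E x).2 = x.2 := by
    intro x
    by_contra hne
    exact key_compat (hk1 x) (hk2 (E x)) (hsum x)
      (hRu mr hmr _ _ (fun h => hne h.symm))
  have hadd : ∀ x, ∃ s, radd (mp.out.val x.1) (mq.out.val (E x).1) = some s ∧
      rmul s (mr.out.val x.2) = some (d (e1.symm x)) := by
    intro x
    have h2 := hk2 (E x)
    rw [hE] at h2
    exact key_add (hk1 x) h2 (hsum x)
  have hPinj : ∀ i i', (mp.out.val i).2 = (mp.out.val i').2 → i = i' := by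
    intro i i' h
    by_contra hne
    obtain ⟨x, u, u', hu, hu', hn⟩ := hPu mp hmp i i' hne
    rw [h, hu'] at hu
    exact hn (Option.some.inj hu).symm
  have hst : ∀ x, (mp.out.val x.1).2 = (mq.out.val (E x).1).2 := fun x => by
    obtain ⟨s, hs, -⟩ := hadd x
    exact (radd_store hs).2
  have hbij : Function.Bijective (fun i => (E (i, j0)).1) := by
    constructor
    · intro i i' h
      have : E (i, j0) = E (i', j0) := Prod.ext h (by rw [hE, hE])
      exact congrArg Prod.fst (E.injective this)
    · intro i'
      have h2 := hE (E.symm (i', j0))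
      rw [Equiv.apply_symm_apply] at h2
      refine ⟨(E.symm (i', j0)).1, ?_⟩
      have : ((E.symm (i', j0)).1, j0) = E.symm (i', j0) := Prod.ext rfl h2
      simp only [this, Equiv.apply_symm_apply]
  have hφ : ∀ x, (E x).1 = (E (x.1, j0)).1 := by
    intro x
    obtain ⟨i1, h1⟩ := hbij.2 (E x).1
    have h1 : (E (i1, j0)).1 = (E x).1 := h1
    have : i1 = x.1 := hPinj _ _ (by rw [hst x, ← h1]; exact hst (i1, j0))
    rw [← h1, this]
  choose s hs hs' using fun i => hadd (i, j0)
  refine ⟨MSet.mk mp.out.idx s, ⟨MSet.mk mp.out.idx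
    (fun i => (mp.out.val i, mq.out.val (E (i, j0)).1)), ?_, ?_, ?_⟩, mr, hmr, ?_⟩
  · rw [MSet.map_mk]
    exact (MSet.mk_out mp).symm ▸ hmp
  · rw [MSet.map_mk]
    have : MSet.mk mp.out.idx (fun i => mq.out.val (E (i, j0)).1) = mq :=
      (MSet.mk_eq (Equiv.ofBijective _ hbij) (fun i => rfl)).trans (MSet.mk_out mq)
    exact this.symm ▸ hmq
  · exact msumr_intro hs
  · have h := mprodM_intro (f := s) (g := mr.out.val) (k := fun x => d (e1.symm x)) (by
      intro x
      obtain ⟨t, ht, ht'⟩ := hadd x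
      rw [hφ, hs] at ht
      rw [Option.some.inj ht]
      exact ht')
    rw [MSet.mk_out] at h
    rw [h]
    congr 1
    exact MSet.mk_eq e1.symm (fun x => rfl)
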